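/- For Re(z) > 0 and every integer n ≥ 1, ∫₀^1 t^{n-1} exp(z − z/t) dt = (1/n!) ∫₀^∞ t^n e^{-t}/(t+z) dt; that is, the converging factor of the Euler series admits the integral representation φ_n(z) = ∫₀^1 t^{n-1} e^{z − z/t} dt. -/

import Mathlib

open MeasureTheory Complex intervalIntegral

lemma integral_pow_mul_exp_neg_mul_Ioi_complex (n : ℕ) {r : ℝ} (hr : 0 < r) :
    ∫ s in Set.Ioi (0:ℝ), ((s : ℂ) ^ n * Real.exp (-(r * s))) =
      (Nat.factorial n : ℂ) * ((r : ℂ)⁻¹) ^ (n + 1) := by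
  have h := Real.integral_rpow_mul_exp_neg_mul_Ioi (a := (n : ℝ) + 1) (by positivity) hr
  simp only [add_sub_cancel_right, Real.rpow_natCast, Real.Gamma_nat_eq_factorial] at h
  have h2 : (1 / r) ^ ((n : ℝ) + 1) = (r⁻¹) ^ (n + 1) := by
    rw [one_div, ← Real.rpow_natCast]; push_cast; rfl
  rw [h2] at h
  calc _ = ∫ s in Set.Ioi (0:ℝ), ((s ^ n * Real.exp (-(r * s)) : ℝ) : ℂ) := by
        push_cast; rfl
    _ = _ := by rw [integral_complex_ofReal, h]; push_cast; ring

lemma integral_exp_neg_mul_Ioi_complex {w : ℂ} (hw : 0 < w.re) :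
    ∫ u in Set.Ioi (0:ℝ), Complex.exp (-w * u) = 1 / w := by
  rw [integral_exp_mul_complex_Ioi (by simpa using hw)]
  simp [neg_div_neg_eq]

lemma integrable_prod_pow_mul_exp {z : ℂ} (hz : 0 < z.re) (n : ℕ) :
    Integrable (Function.uncurry fun s u : ℝ =>
      (s : ℂ) ^ n * Real.exp (-s) * Complex.exp (-(s + z) * u))
      ((volume.restrict (Set.Ioi 0)).prod (volume.restrict (Set.Ioi 0))) := by
  have h1 : Integrable (fun s : ℝ => s ^ n * Real.exp (-s)) (volume.restrict (Set.Ioi 0)) := by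
    have h := Real.GammaIntegral_convergent (s := (n : ℝ) + 1) (by positivity)
    simp only [add_sub_cancel_right, Real.rpow_natCast, mul_comm (Real.exp _)] at h
    exact h
  have h2 : Integrable (fun u : ℝ => Complex.exp (-z * u)) (volume.restrict (Set.Ioi 0)) :=
    integrableOn_exp_mul_complex_Ioi (by simpa using hz) 0
  refine (h1.mul_prod h2.norm).mono' (by fun_prop) ?_
  rw [Measure.prod_restrict]
  filter_upwards [ae_restrict_mem (measurableSet_Ioi.prod measurableSet_Ioi)] with p hp
  obtain ⟨hs, hu⟩ := hp
  simp only [Set.mem_Ioi] at hs hu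
  simp only [Function.uncurry, norm_mul, norm_pow, Complex.norm_exp, Complex.norm_real,
    Real.norm_eq_abs, abs_of_pos hs, Real.abs_exp]
  gcongr ?_ * Real.exp ?_
  simp
  nlinarith [mul_pos hs hu]

lemma image_inv_one_add_Ioi :
    (fun u : ℝ => (1 + u)⁻¹) '' Set.Ioi 0 = Set.Ioo 0 1 := by
  ext t
  simp only [Set.mem_image, Set.mem_Ioi, Set.mem_Ioo]
  constructor
  · rintro ⟨u, hu, rfl⟩
    exact ⟨by positivity, inv_lt_one_of_one_lt₀ (by linarith)⟩
  · rintro ⟨h0, h1⟩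
    exact ⟨t⁻¹ - 1, by linarith [(one_lt_inv₀ h0).2 h1], by simp⟩

lemma intervalIntegral_eq_integral_Ioi_inv_one_add (f : ℝ → ℂ) :
    ∫ t in (0:ℝ)..1, f t =
      ∫ u in Set.Ioi (0:ℝ), (((1 + u)⁻¹ ^ 2 : ℝ) : ℂ) * f ((1 + u)⁻¹) := by
  rw [intervalIntegral.integral_of_le zero_le_one, integral_Ioc_eq_integral_Ioo,
    ← image_inv_one_add_Ioi,
    integral_image_eq_integral_abs_deriv_smul (f' := fun u => -1 / (1 + u) ^ 2)
      measurableSet_Ioi]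
  · refine setIntegral_congr_fun measurableSet_Ioi fun u _ => ?_
    simp [abs_div]
  · intro u hu
    have hu : (0:ℝ) < u := hu
    exact (((hasDerivAt_id u).const_add 1).inv (by simp; linarith)).hasDerivWithinAt
  · intro a _ b _ hab
    simpa using hab

theorem euler_convergingFactor_integralRep (z : ℂ) (hz : 0 < z.re) (n : ℕ) (hn : 1 ≤ n) :
    ∫ t in (0:ℝ)..1, (t : ℂ) ^ (n - 1) * Complex.exp (z - z / (t : ℂ))
      = (1 / (Nat.factorial n : ℂ)) *
        ∫ t in Set.Ioi (0:ℝ), ((t : ℂ) ^ n * Real.exp (-t) / ((t : ℂ) + z)) := by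
  have hR : ∫ t in Set.Ioi (0:ℝ), ((t : ℂ) ^ n * Real.exp (-t) / ((t : ℂ) + z)) =
      ∫ s in Set.Ioi (0:ℝ), ∫ u in Set.Ioi (0:ℝ),
        (s : ℂ) ^ n * Real.exp (-s) * Complex.exp (-(s + z) * u) := by
    refine setIntegral_congr_fun measurableSet_Ioi fun s hs => ?_
    have hs : (0:ℝ) < s := hs
    rw [MeasureTheory.integral_const_mul,
      integral_exp_neg_mul_Ioi_complex (by simp; linarith), mul_one_div]
  rw [hR, integral_integral_swap (integrable_prod_pow_mul_exp hz n),
    intervalIntegral_eq_integral_Ioi_inv_one_add, ← MeasureTheory.integral_const_mul]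
  refine setIntegral_congr_fun measurableSet_Ioi fun u hu => ?_
  have hu : (0:ℝ) < u := hu
  have hin : ∫ s in Set.Ioi (0:ℝ),
      (s : ℂ) ^ n * Real.exp (-s) * Complex.exp (-(s + z) * u) =
      Complex.exp (-z * u) * ((Nat.factorial n : ℂ) * (((1 + u : ℝ) : ℂ)⁻¹) ^ (n + 1)) := by
    rw [← integral_pow_mul_exp_neg_mul_Ioi_complex n (by linarith : 0 < 1 + u),
      ← MeasureTheory.integral_const_mul]
    congr 1 with s
    rw [mul_left_comm, mul_assoc]
    push_cast
    rw [← Complex.exp_add, ← Complex.exp_add]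
    ring_nf
  rw [hin]
  have hf : (Nat.factorial n : ℂ) ≠ 0 := by exact_mod_cast n.factorial_ne_zero
  obtain ⟨m, rfl⟩ := Nat.exists_eq_add_of_le' hn
  have he : z - z / (((1 + u)⁻¹ : ℝ) : ℂ) = -z * u := by
    push_cast; rw [div_inv_eq_mul]; ring
  rw [he, Nat.add_sub_cancel]
  rw [mul_left_comm (Complex.exp _), one_div, inv_mul_cancel_left₀ hf]
  push_cast
  ring
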